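/- Let L be a free abelian group of rank 2n with an action of a dihedral group D = ⟨t,u⟩ of order 8 whose central involution acts as -1, and let Q = Tel(t)/2Tel(t). Then Q is a free 𝔽₂⟨u⟩-module, and the fixed points of u on Q are exactly the image of u-1, i.e., Q^u = Q(u-1). -/

import Mathlib

/-- The `+1`-eigenlattice of an involution `t` on `L`. -/
def eigP {L : Type*} [AddCommGroup L] (t : Module.End ℤ L) : Submodule ℤ L :=
  LinearMap.ker (t - 1)

/-- The `-1`-eigenlattice of an involution `t` on `L`. -/
def eigM {L : Type*} [AddCommGroup L] (t : Module.End ℤ L) : Submodule ℤ L :=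
  LinearMap.ker (t + 1)

/-- The total eigenlattice `Tel(t) = L^+(t) + L^-(t)`. -/
def Tel {L : Type*} [AddCommGroup L] (t : Module.End ℤ L) : Submodule ℤ L :=
  eigP t ⊔ eigM t


/-- The doubled total eigenlattice `2·Tel(t)`. -/
def twoTel {L : Type*} [AddCommGroup L] (t : Module.End ℤ L) : Submodule ℤ L :=
  Submodule.map ((2 : ℤ) • (1 : Module.End ℤ L)) (Tel t)

section InvolutionEigenlattices

variable {L : Type*} [AddCommGroup L] {t u : Module.End ℤ L} {x : L}

theorem mem_eigP : x ∈ eigP t ↔ t x = x := by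
  simp [eigP, sub_eq_zero]

theorem mem_eigM : x ∈ eigM t ↔ t x = -x := by
  simp [eigM, add_eq_zero_iff_eq_neg]

theorem mem_Tel : x ∈ Tel t ↔ ∃ a ∈ eigP t, ∃ b ∈ eigM t, a + b = x :=
  Submodule.mem_sup

theorem mem_twoTel : x ∈ twoTel t ↔ ∃ y ∈ Tel t, (2 : ℤ) • y = x :=
  Submodule.mem_map

theorem eq_of_add_eq_add_of_mem_eig [Module.Free ℤ L] {a b c d : L}
    (ha : a ∈ eigP t) (hb : b ∈ eigM t) (hc : c ∈ eigP t) (hd : d ∈ eigM t)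
    (h : a + b = c + d) : a = c ∧ b = d := by
  have : IsAddTorsionFree L := Module.isTorsionFree_int_iff_isAddTorsionFree.mp inferInstance
  rw [mem_eigP] at ha hc
  rw [mem_eigM] at hb hd
  have h' : a - b = c - d := by
    simpa [ha, hb, hc, hd, sub_eq_add_neg] using congrArg t h
  have hac : a = c := by
    refine nsmul_right_injective two_ne_zero ?_
    calc 2 • a = (a + b) + (a - b) := by abel
      _ = (c + d) + (c - d) := by rw [h, h']
      _ = 2 • c := by abel
  exact ⟨hac, by simpa [hac] using h⟩

theorem apply_apply_eq_neg (ht : t * t = 1) (hu : u * u = 1) (hz : (t * u) * (t * u) = -1)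
    (x : L) : t (u x) = -u (t x) := by
  have h1 : t (u (t (u (u (t x))))) = -(u (t x)) := by
    simpa using LinearMap.congr_fun hz (u (t x))
  have h2 (y : L) : u (u y) = y := LinearMap.congr_fun hu y
  have h3 (y : L) : t (t y) = y := LinearMap.congr_fun ht y
  rwa [h2, h3] at h1

theorem map_eigP_eq_eigM (hu : u * u = 1) (htu : ∀ x, t (u x) = -u (t x)) :
    Submodule.map u (eigP t) = eigM t := by
  have huu (y : L) : u (u y) = y := LinearMap.congr_fun hu y
  ext x
  rw [Submodule.mem_map]
  constructor
  · rintro ⟨a, ha, rfl⟩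
    rw [mem_eigM, htu, mem_eigP.mp ha]
  · intro hx
    exact ⟨u x, by rw [mem_eigP, htu, mem_eigM.mp hx, map_neg, neg_neg], huu x⟩

theorem map_eigM_eq_eigP (hu : u * u = 1) (htu : ∀ x, t (u x) = -u (t x)) :
    Submodule.map u (eigM t) = eigP t := by
  rw [← map_eigP_eq_eigM hu htu, ← Submodule.map_comp]
  exact (congrArg (Submodule.map · _) hu).trans (Submodule.map_id _)

theorem map_Tel_eq_Tel (hu : u * u = 1) (htu : ∀ x, t (u x) = -u (t x)) :
    Submodule.map u (Tel t) = Tel t := by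
  rw [Tel, Submodule.map_sup, map_eigP_eq_eigM hu htu, map_eigM_eq_eigP hu htu, sup_comm]

theorem map_mkQ_eigP_inf_map_mkQ_eigM [Module.Free ℤ L] :
    Submodule.map (twoTel t).mkQ (eigP t) ⊓ Submodule.map (twoTel t).mkQ (eigM t) = ⊥ := by
  rw [eq_bot_iff]
  rintro _ ⟨⟨a, ha, rfl⟩, ⟨b, hb, hab⟩⟩
  rw [SetLike.mem_coe] at ha hb
  obtain ⟨y, hy, h⟩ := mem_twoTel.mp ((Submodule.Quotient.eq _).mp hab)
  obtain ⟨p, hp, m, hm, rfl⟩ := mem_Tel.mp hy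
  rw [smul_add] at h
  have h' := (eq_of_add_eq_add_of_mem_eig (Submodule.smul_mem _ 2 hp)
    (Submodule.smul_mem _ 2 hm) (neg_mem ha) hb (by rw [h]; abel)).1
  rw [Submodule.mem_bot, Submodule.mkQ_apply, Submodule.Quotient.mk_eq_zero, mem_twoTel]
  exact ⟨-p, neg_mem (mem_Tel.mpr ⟨p, hp, 0, zero_mem _, add_zero p⟩), by
    rw [smul_neg, h', neg_neg]⟩

theorem exists_sub_mem_twoTel [Module.Free ℤ L] (hu : u * u = 1)
    (htu : ∀ x, t (u x) = -u (t x)) (hx : x ∈ Tel t) (hux : u x - x ∈ twoTel t) :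
    ∃ y ∈ Tel t, (u y - y) - x ∈ twoTel t := by
  obtain ⟨a, ha, b, hb, rfl⟩ := mem_Tel.mp hx
  obtain ⟨w, hw, h⟩ := mem_twoTel.mp hux
  obtain ⟨c, hc, d, hd, rfl⟩ := mem_Tel.mp hw
  have hua : u a ∈ eigM t := map_eigP_eq_eigM hu htu ▸ Submodule.mem_map_of_mem ha
  have hub : u b ∈ eigP t := map_eigM_eq_eigP hu htu ▸ Submodule.mem_map_of_mem hb
  rw [smul_add, map_add] at h
  have h' := (eq_of_add_eq_add_of_mem_eig (Submodule.smul_mem _ 2 hc)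
    (Submodule.smul_mem _ 2 hd) (sub_mem hub ha) (sub_mem hua hb) (by rw [h]; abel)).1
  refine ⟨b, Submodule.mem_sup_right hb, mem_twoTel.mpr ⟨c - b,
    sub_mem (Submodule.mem_sup_left hc) (Submodule.mem_sup_right hb), ?_⟩⟩
  rw [smul_sub, h', two_smul]
  abel

theorem map_mkQ_fixed_eq_map_mkQ_image [Module.Free ℤ L] (hu : u * u = 1)
    (htu : ∀ x, t (u x) = -u (t x)) :
    Submodule.map (twoTel t).mkQ (Tel t ⊓ Submodule.comap (u - 1) (twoTel t))
      = Submodule.map (twoTel t).mkQ (Submodule.map (u - 1) (Tel t)) := by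
  apply le_antisymm
  · rintro _ ⟨x, ⟨hx, hux⟩, rfl⟩
    obtain ⟨y, hy, hyx⟩ := exists_sub_mem_twoTel hu htu hx hux
    exact ⟨(u - 1) y, Submodule.mem_map_of_mem hy, (Submodule.Quotient.eq _).mpr hyx⟩
  · refine Submodule.map_mono ?_
    rintro _ ⟨y, hy, rfl⟩
    rw [SetLike.mem_coe] at hy
    have huy : u y ∈ Tel t := map_Tel_eq_Tel hu htu ▸ Submodule.mem_map_of_mem hy
    have huuy : u (u y) = y := LinearMap.congr_fun hu y
    refine ⟨sub_mem huy hy, mem_twoTel.mpr ⟨y - u y, sub_mem hy huy, ?_⟩⟩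
    simp only [LinearMap.sub_apply, Module.End.one_apply, map_sub, huuy, two_smul]
    abel

end InvolutionEigenlattices

/-- In `Q = Tel(t)/2Tel(t)` (realized as the image of `Tel(t)` in `L/2Tel(t)`),
`Q` is a free `𝔽₂⟨u⟩`-module (it splits as `S̄ ⊕ S̄·u`), and the fixed points of `u`
on `Q` are exactly the image of `u - 1`: `Q^u = Q(u-1)`. -/
theorem q_free_and_fixed_eq_image {L : Type*} [AddCommGroup L]
    [Module.Free ℤ L] [Module.Finite ℤ L] (n : ℕ)
    (hrank : Module.finrank ℤ L = 2 * n)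
    (t u : Module.End ℤ L) (ht : t * t = 1) (hu : u * u = 1)
    (hz : (t * u) * (t * u) = -1) :
    (∃ S : Submodule ℤ L, S ≤ Tel t ∧
        Submodule.map (twoTel t).mkQ S ⊔ Submodule.map (twoTel t).mkQ (Submodule.map u S)
          = Submodule.map (twoTel t).mkQ (Tel t) ∧
        Submodule.map (twoTel t).mkQ S ⊓ Submodule.map (twoTel t).mkQ (Submodule.map u S)
          = ⊥) ∧
      Submodule.map (twoTel t).mkQ (Tel t ⊓ Submodule.comap (u - 1) (twoTel t))
        = Submodule.map (twoTel t).mkQ (Submodule.map (u - 1) (Tel t)) := by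
  have htu := apply_apply_eq_neg ht hu hz
  refine ⟨⟨eigP t, le_sup_left, ?_, ?_⟩, map_mkQ_fixed_eq_map_mkQ_image hu htu⟩
  · rw [map_eigP_eq_eigM hu htu, ← Submodule.map_sup, Tel]
  · rw [map_eigP_eq_eigM hu htu, map_mkQ_eigP_inf_map_mkQ_eigM]
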